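/- arXiv:1210.0590 — 3 statements merged into one kernel-verified Lean document; each statement's English description precedes it below -/
import Mathlib

section
/- Let 2 < q < ∞. There exists a constant C depending only on q with the following property. Let Δ = {z₁,z₂,z₃} and Δ' = {z₁',z₂',z₃'} be two triangles (each a set of three non-collinear points) in ℝ², and let Q, Q', Q̃ be squares with Δ ⊆ Q, Δ' ⊆ Q', and Q ∪ Q' ⊆ Q̃. Then for every C² function F : ℝ² → ℝ, ‖∇P_Δ[F] − ∇P_{Δ'}[F]‖₂ ≤ C·{ (R_Δ/diam Δ)·diam Q·((1/|Q|)∫_Q |∇²F|^q dz)^{1/q} + (R_{Δ'}/diam Δ')·diam Q'·((1/|Q'|)∫_{Q'} |∇²F|^q dz)^{1/q} + diam Q̃·((1/|Q̃|)∫_{Q̃} |∇²F|^q dz)^{1/q} }. -/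
open MeasureTheory
open scoped RealInnerProductSpace

noncomputable section

/-- The plane `ℝ²`, regarded as a Euclidean space. -/
abbrev E2 := EuclideanSpace ℝ (Fin 2)

/-- The square `Q(c,r)`: the closed ball of center `c` and radius `r` in the uniform norm,
regarded as a subset of Euclidean `ℝ²`. -/
def square (c : E2) (r : ℝ) : Set E2 := {y : E2 | ∀ i, |y i - c i| ≤ r}

/-- `|∇²F(z)|`: the Euclidean norm of the vector of all second-order partial derivatives
of `F` at `z`. -/
def hessNorm (F : E2 → ℝ) (z : E2) : ℝ :=
  Real.sqrt (∑ i : Fin 2, ∑ j : Fin 2,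
    (iteratedFDeriv ℝ 2 F z ![EuclideanSpace.single i (1 : ℝ),
      EuclideanSpace.single j (1 : ℝ)]) ^ 2)

open Module in
/-- Averaging over the shrunken copy `x + t (K - x)` of a compact convex set costs at most a
factor `t ^ (-d / q)`. -/
lemma setAverage_comp_homothety_le {E : Type*} [NormedAddCommGroup E] [NormedSpace ℝ E]
    [MeasurableSpace E] [BorelSpace E] [FiniteDimensional ℝ E] {μ : Measure E}
    [μ.IsAddHaarMeasure] {K : Set E} (hK : IsCompact K) (hconv : Convex ℝ K) (hμ : μ K ≠ 0)
    {q : ℝ} (hq : 1 ≤ q) {h : E → ℝ} (hcont : Continuous h) (h_nonneg : ∀ z, 0 ≤ h z)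
    {x : E} (hx : x ∈ K) {t : ℝ} (ht : 0 < t) (ht1 : t ≤ 1) :
    ⨍ y in K, h (x + t • (y - x)) ∂μ ≤
      t ^ (-(finrank ℝ E / q)) * (⨍ y in K, h y ^ q ∂μ) ^ (1 / q) := by
  have hq0 : 0 < q := by linarith
  have hφ : Continuous fun y : E => h (x + t • (y - x)) := by fun_prop
  have hpow : Continuous fun y => h y ^ q := hcont.rpow_const fun _ => Or.inr hq0.le
  have hφpow : Continuous fun y : E => h (x + t • (y - x)) ^ q :=
    hφ.rpow_const fun _ => Or.inr hq0.le
  have jensen : (⨍ y in K, h (x + t • (y - x)) ∂μ) ^ q ≤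
      ⨍ y in K, h (x + t • (y - x)) ^ q ∂μ :=
    (convexOn_rpow hq).map_set_average_le
      (Real.continuous_rpow_const hq0.le).continuousOn isClosed_Ici hμ hK.measure_ne_top
      (Filter.Eventually.of_forall fun y => h_nonneg _)
      (hφ.continuousOn.integrableOn_compact hK) (hφpow.continuousOn.integrableOn_compact hK)
  have hind : Integrable (K.indicator fun y => h y ^ q) μ :=
    (integrable_indicator_iff hK.measurableSet).2 (hpow.continuousOn.integrableOn_compact hK)
  have hind_nonneg : ∀ z, 0 ≤ K.indicator (fun y => h y ^ q) z := fun z =>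
    Set.indicator_nonneg (fun y _ => Real.rpow_nonneg (h_nonneg y) q) z
  have shift : ∀ y : E, x + t • (y - x) = t • y + (x - t • x) := fun y => by
    rw [smul_sub]; abel
  have change_vars : ∫ y, K.indicator (fun y => h y ^ q) (x + t • (y - x)) ∂μ =
      (t ^ finrank ℝ E)⁻¹ * ∫ y in K, h y ^ q ∂μ := by
    simp_rw [shift]
    rw [Measure.integral_comp_smul μ
        (fun y => K.indicator (fun y => h y ^ q) (y + (x - t • x))) t,
      integral_add_right_eq_self, integral_indicator hK.measurableSet, smul_eq_mul,
      abs_of_nonneg (by positivity)]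
  have hcomp_int : Integrable (fun y => K.indicator (fun y => h y ^ q) (x + t • (y - x))) μ := by
    simp_rw [shift]
    exact (hind.comp_add_right (x - t • x)).comp_smul ht.ne'
  have scale : ∫ y in K, h (x + t • (y - x)) ^ q ∂μ ≤
      (t ^ finrank ℝ E)⁻¹ * ∫ y in K, h y ^ q ∂μ := by
    rw [← change_vars]
    refine le_trans (le_of_eq ?_) (setIntegral_le_integral (s := K) hcomp_int
      (Filter.Eventually.of_forall fun y => hind_nonneg _))
    refine setIntegral_congr_fun hK.measurableSet fun y hy => ?_
    exact (Set.indicator_of_mem (hconv.add_smul_sub_mem hx hy ⟨ht.le, ht1⟩)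
      (fun y => h y ^ q)).symm
  have avg_nonneg : 0 ≤ ⨍ y in K, h y ^ q ∂μ :=
    integral_nonneg fun y => Real.rpow_nonneg (h_nonneg y) q
  have bound : (⨍ y in K, h (x + t • (y - x)) ∂μ) ^ q ≤
      (t ^ finrank ℝ E)⁻¹ * ⨍ y in K, h y ^ q ∂μ := by
    refine jensen.trans ?_
    rw [setAverage_eq, setAverage_eq, smul_eq_mul, smul_eq_mul, mul_left_comm]
    gcongr
  have base_nonneg : 0 ≤ ⨍ y in K, h (x + t • (y - x)) ∂μ :=
    integral_nonneg fun y => h_nonneg _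
  calc ⨍ y in K, h (x + t • (y - x)) ∂μ
      = ((⨍ y in K, h (x + t • (y - x)) ∂μ) ^ q) ^ (1 / q) := by
        rw [← Real.rpow_mul base_nonneg, mul_one_div_cancel hq0.ne', Real.rpow_one]
    _ ≤ ((t ^ finrank ℝ E)⁻¹ * ⨍ y in K, h y ^ q ∂μ) ^ (1 / q) := by gcongr
    _ = _ := by
        rw [Real.mul_rpow (by positivity) avg_nonneg, ← Real.rpow_natCast, ← Real.rpow_neg ht.le,
          ← Real.rpow_mul ht.le]
        congr 2
        ring

open Module in
/-- Morrey's inequality on a compact convex set `K`: a `C¹` function deviates from its mean over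
`K` by at most a multiple of `diam K` times the `L^q` average of its derivative. -/
lemma norm_sub_setAverage_le {E : Type*} [NormedAddCommGroup E] [NormedSpace ℝ E]
    [MeasurableSpace E] [BorelSpace E] [FiniteDimensional ℝ E] {μ : Measure E}
    [μ.IsAddHaarMeasure] {V : Type*} [NormedAddCommGroup V] [NormedSpace ℝ V] [CompleteSpace V]
    {K : Set E} (hK : IsCompact K) (hconv : Convex ℝ K) (hμ : μ K ≠ 0)
    {q : ℝ} (hq : 1 ≤ q) (hdim : finrank ℝ E < q) {G : E → V} (hG : ContDiff ℝ 1 G) {h : E → ℝ}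
    (hcont : Continuous h) (hGh : ∀ z, ‖fderiv ℝ G z‖ ≤ h z) {x : E} (hx : x ∈ K) :
    ‖G x - ⨍ y in K, G y ∂μ‖ ≤
      Metric.diam K * (q / (q - finrank ℝ E)) * (⨍ y in K, h y ^ q ∂μ) ^ (1 / q) := by
  have hq0 : 0 < q := by linarith
  have h_nonneg : ∀ z, 0 ≤ h z := fun z => (norm_nonneg _).trans (hGh z)
  have hG' : Continuous (fderiv ℝ G) := hG.continuous_fderiv one_ne_zero
  have hfin : μ K ≠ ⊤ := hK.measure_ne_top
  have : IsFiniteMeasure (μ.restrict K) := ⟨by simpa using hfin.lt_top⟩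
  set A := (⨍ y in K, h y ^ q ∂μ) ^ (1 / q)
  have hcomp : Continuous (Function.uncurry fun (t : ℝ) (y : E) => h (x + t • (y - x))) := by
    unfold Function.uncurry; fun_prop
  have segment_bound : ∀ y ∈ K,
      ‖G x - G y‖ ≤ Metric.diam K * ∫ t in (0 : ℝ)..1, h (x + t • (y - x)) := by
    intro y hy
    have hderiv : ∀ t ∈ Set.uIcc (0 : ℝ) 1, HasDerivAt (fun t : ℝ => G (x + t • (y - x)))
        (fderiv ℝ G (x + t • (y - x)) (y - x)) t := fun t _ => by
      have hlin : HasDerivAt (fun t : ℝ => x + t • (y - x)) (y - x) t := by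
        simpa using ((hasDerivAt_id t).smul_const (y - x)).const_add x
      exact ((hG.differentiable one_ne_zero _).hasFDerivAt).comp_hasDerivAt t hlin
    have hc : Continuous fun t : ℝ => fderiv ℝ G (x + t • (y - x)) (y - x) := by fun_prop
    have key := intervalIntegral.integral_eq_sub_of_hasDerivAt hderiv
      (hc.intervalIntegrable 0 1)
    simp only [one_smul, zero_smul, add_zero, add_sub_cancel] at key
    rw [norm_sub_rev, ← key, ← intervalIntegral.integral_const_mul]
    refine intervalIntegral.norm_integral_le_of_norm_le zero_le_one
      (Filter.Eventually.of_forall fun t _ => ?_)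
      (Continuous.intervalIntegrable (by fun_prop) 0 1)
    calc _ ≤ ‖fderiv ℝ G (x + t • (y - x))‖ * ‖y - x‖ := ContinuousLinearMap.le_opNorm _ _
      _ ≤ h (x + t • (y - x)) * Metric.diam K := by
        gcongr
        · exact h_nonneg _
        · exact hGh _
        · rw [← dist_eq_norm]
          exact Metric.dist_le_diam_of_mem hK.isBounded hy hx
      _ = _ := mul_comm _ _
  have hswap : Integrable (Function.uncurry fun (t : ℝ) (y : E) => h (x + t • (y - x)))
      ((volume.restrict (Set.uIoc (0 : ℝ) 1)).prod (μ.restrict K)) := by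
    rw [Measure.prod_restrict]
    refine (hcomp.continuousOn.integrableOn_compact (isCompact_uIcc.prod hK)).mono_set
      (Set.prod_mono_left Set.uIoc_subset_uIcc)
  have hGint : IntegrableOn G K μ := hG.continuous.continuousOn.integrableOn_compact hK
  have hInt : IntegrableOn (fun y => ∫ t in (0 : ℝ)..1, h (x + t • (y - x))) K μ := by
    refine ContinuousOn.integrableOn_compact hK (Continuous.continuousOn ?_)
    exact intervalIntegral.continuous_parametric_intervalIntegral_of_continuous'
      (by unfold Function.uncurry; fun_prop) 0 1
  have mean : G x - ⨍ y in K, G y ∂μ = (μ.real K)⁻¹ • ∫ y in K, (G x - G y) ∂μ := by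
    rw [integral_sub (integrable_const _) hGint, smul_sub, ← setAverage_eq, ← setAverage_eq,
      setAverage_const hμ hfin]
  have hpow : IntervalIntegrable (fun t : ℝ => t ^ (-(finrank ℝ E / q)) * A) volume 0 1 := by
    refine (intervalIntegral.intervalIntegrable_rpow' ?_).mul_const A
    have := (div_lt_one hq0).2 hdim
    linarith
  calc ‖G x - ⨍ y in K, G y ∂μ‖
      ≤ (μ.real K)⁻¹ *
          ∫ y in K, (Metric.diam K * ∫ t in (0 : ℝ)..1, h (x + t • (y - x))) ∂μ := by
        rw [mean, norm_smul, Real.norm_of_nonneg (by positivity)]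
        gcongr
        exact norm_integral_le_of_norm_le (hInt.const_mul _)
          ((ae_restrict_iff' hK.measurableSet).2 (Filter.Eventually.of_forall segment_bound))
    _ = Metric.diam K * ∫ t in (0 : ℝ)..1, ⨍ y in K, h (x + t • (y - x)) ∂μ := by
        simp_rw [setAverage_eq, smul_eq_mul]
        rw [integral_const_mul, intervalIntegral.integral_const_mul,
          intervalIntegral_integral_swap hswap, mul_left_comm]
    _ ≤ Metric.diam K * ∫ t in (0 : ℝ)..1, t ^ (-(finrank ℝ E / q)) * A := by
        gcongr
        refine (Real.le_norm_self _).trans (intervalIntegral.norm_integral_le_of_norm_le zero_le_one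
          (Filter.Eventually.of_forall fun t ht => ?_) hpow)
        refine (Real.norm_of_nonneg ?_).trans_le
          (setAverage_comp_homothety_le hK hconv hμ hq hcont h_nonneg hx ht.1 ht.2)
        exact integral_nonneg fun y => h_nonneg _
    _ = _ := by
        have hlt := (div_lt_one hq0).2 hdim
        rw [intervalIntegral.integral_mul_const, integral_rpow (Or.inl (by linarith)),
          Real.one_rpow, Real.zero_rpow (by linarith), mul_assoc]
        congr 2
        have hsub : q - finrank ℝ E ≠ 0 := by linarith
        have hsub' : -(finrank ℝ E / q) + 1 = (q - finrank ℝ E) / q := by field_simp; ring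
        rw [hsub', sub_zero, one_div_div]

lemma square_eq_preimage (c : E2) (r : ℝ) :
    square c r = EuclideanSpace.equiv (Fin 2) ℝ ⁻¹'
      Set.univ.pi fun i => Set.Icc (c i - r) (c i + r) := by
  ext y
  simp only [square, Set.mem_ofPred_eq, Set.mem_preimage, Set.mem_pi, Set.mem_univ, true_imp_iff,
    Set.mem_Icc, abs_le]
  refine forall_congr' fun i => ?_
  change _ ↔ c i - r ≤ y i ∧ y i ≤ c i + r
  constructor <;> rintro ⟨h₁, h₂⟩ <;> constructor <;> linarith

lemma isCompact_square (c : E2) (r : ℝ) : IsCompact (square c r) := by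
  rw [square_eq_preimage]
  exact (EuclideanSpace.equiv (Fin 2) ℝ).toHomeomorph.isCompact_preimage.2
    (isCompact_univ_pi fun _ => isCompact_Icc)

lemma convex_square (c : E2) (r : ℝ) : Convex ℝ (square c r) := by
  rw [square_eq_preimage]
  exact (convex_pi fun i _ => convex_Icc _ _).linear_preimage
    (EuclideanSpace.equiv (Fin 2) ℝ).toLinearEquiv.toLinearMap

lemma volume_square_ne_zero (c : E2) {r : ℝ} (hr : 0 < r) : volume (square c r) ≠ 0 := by
  have hsub : Metric.ball c r ⊆ square c r := fun y hy i => by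
    rw [← PiLp.sub_apply, ← Real.norm_eq_abs]
    exact (PiLp.norm_apply_le _ i).trans (by rw [← dist_eq_norm]; exact (Metric.mem_ball.1 hy).le)
  exact ((Metric.measure_ball_pos volume c hr).trans_le (measure_mono hsub)).ne'

lemma continuous_hessNorm {F : E2 → ℝ} (hF : ContDiff ℝ 2 F) : Continuous (hessNorm F) := by
  have := hF.continuous_iteratedFDeriv (m := 2) le_rfl
  unfold hessNorm
  fun_prop

lemma norm_fderiv_fderiv_le_hessNorm (F : E2 → ℝ) (z : E2) :
    ‖fderiv ℝ (fderiv ℝ F) z‖ ≤ hessNorm F z := by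
  set B := fderiv ℝ (fderiv ℝ F) z
  refine ContinuousLinearMap.opNorm_le_bound₂ _ (Real.sqrt_nonneg _) fun u w => ?_
  have expand : ∀ x : E2, x = ∑ i, x i • EuclideanSpace.single i (1 : ℝ) := fun x => by
    ext j; fin_cases j <;> simp [Fin.sum_univ_two]
  set b : Fin 2 → Fin 2 → ℝ := fun i j =>
    B (EuclideanSpace.single i (1 : ℝ)) (EuclideanSpace.single j (1 : ℝ)) with hb
  have hBuw : B u w = u 0 * (w 0 * b 0 0 + w 1 * b 0 1) + u 1 * (w 0 * b 1 0 + w 1 * b 1 1) := by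
    conv_lhs => rw [expand u, expand w]
    simp only [hb, Fin.sum_univ_two, map_add, map_smul, add_apply, smul_apply, smul_eq_mul]
    ring
  have hsum : (0 : ℝ) ≤ b 0 0 ^ 2 + b 0 1 ^ 2 + (b 1 0 ^ 2 + b 1 1 ^ 2) := by positivity
  have hhess : hessNorm F z ^ 2 = b 0 0 ^ 2 + b 0 1 ^ 2 + (b 1 0 ^ 2 + b 1 1 ^ 2) := by
    simp only [hessNorm, iteratedFDeriv_two_apply, Fin.sum_univ_two]
    exact Real.sq_sqrt hsum
  have hnonneg : 0 ≤ hessNorm F z * ‖u‖ * ‖w‖ :=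
    mul_nonneg (mul_nonneg (Real.sqrt_nonneg _) (norm_nonneg u)) (norm_nonneg w)
  refine abs_le_of_sq_le_sq ?_ hnonneg
  rw [mul_pow, mul_pow, hhess, EuclideanSpace.real_norm_sq_eq, EuclideanSpace.real_norm_sq_eq,
    Fin.sum_univ_two, Fin.sum_univ_two, hBuw]
  nlinarith [sq_nonneg (b 0 0 * (u 0 * w 1) - b 0 1 * (u 0 * w 0)),
    sq_nonneg (b 0 0 * (u 1 * w 0) - b 1 0 * (u 0 * w 0)),
    sq_nonneg (b 0 0 * (u 1 * w 1) - b 1 1 * (u 0 * w 0)),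
    sq_nonneg (b 0 1 * (u 1 * w 0) - b 1 0 * (u 0 * w 1)),
    sq_nonneg (b 0 1 * (u 1 * w 1) - b 1 1 * (u 0 * w 1)),
    sq_nonneg (b 1 0 * (u 1 * w 1) - b 1 1 * (u 1 * w 0))]

/-- If the circumradius of a triangle is `R` and the slopes of `w` along the two edges at `z₁` are
at most `M`, then `‖w‖` times the length of the opposite edge is at most `4 M R`. -/
lemma norm_mul_dist_le_of_edge_slopes {z₁ z₂ z₃ o w : E2} {R M : ℝ} (h₁₂ : z₁ ≠ z₂)
    (h₁₃ : z₁ ≠ z₃) (h₂₃ : z₂ ≠ z₃) (hR₁ : dist o z₁ = R) (hR₂ : dist o z₂ = R)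
    (hR₃ : dist o z₃ = R) (h₂ : |⟪w, z₂ - z₁⟫| ≤ M * ‖z₂ - z₁‖)
    (h₃ : |⟪w, z₃ - z₁⟫| ≤ M * ‖z₃ - z₁‖) :
    ‖w‖ * dist z₂ z₃ ≤ 4 * M * R := by
  set a := z₂ - z₁ with ha
  set b := z₃ - z₁ with hb
  set p := o - z₁ with hp
  have hpR : ‖p‖ = R := by rw [hp, ← dist_eq_norm, hR₁]
  have hpa : ‖p - a‖ = R := by rw [hp, ha, sub_sub_sub_cancel_right, ← dist_eq_norm, hR₂]
  have hpb : ‖p - b‖ = R := by rw [hp, hb, sub_sub_sub_cancel_right, ← dist_eq_norm, hR₃]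
  have hab : dist z₂ z₃ = ‖a - b‖ := by rw [ha, hb, sub_sub_sub_cancel_right, dist_eq_norm]
  have ha0 : 0 < ‖a‖ := norm_pos_iff.2 (sub_ne_zero.2 h₁₂.symm)
  have hb0 : 0 < ‖b‖ := norm_pos_iff.2 (sub_ne_zero.2 h₁₃.symm)
  have hab0 : 0 < ‖a - b‖ := hab ▸ dist_pos.2 h₂₃
  have normSq : ∀ x : E2, ‖x‖ ^ 2 = x 0 ^ 2 + x 1 ^ 2 := fun x => by
    rw [EuclideanSpace.real_norm_sq_eq, Fin.sum_univ_two]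
  set d := a 0 * b 1 - a 1 * b 0 with hd
  have hR0 : 0 ≤ R := hpR ▸ norm_nonneg p
  have circumradius : ‖a‖ * ‖b‖ * ‖a - b‖ = 2 * R * |d| := by
    have hpa' : 2 * (p 0 * a 0 + p 1 * a 1) = ‖a‖ ^ 2 := by
      have h := normSq (p - a)
      rw [hpa, ← hpR, normSq p] at h
      rw [normSq a]
      simp only [PiLp.sub_apply] at h
      linarith
    have hpb' : 2 * (p 0 * b 0 + p 1 * b 1) = ‖b‖ ^ 2 := by
      have h := normSq (p - b)
      rw [hpb, ← hpR, normSq p] at h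
      rw [normSq b]
      simp only [PiLp.sub_apply] at h
      linarith
    refine (pow_left_inj₀ (by positivity) (by positivity) two_ne_zero).1 ?_
    have h₀ : 2 * p 0 * d = ‖a‖ ^ 2 * b 1 - ‖b‖ ^ 2 * a 1 := by
      rw [← hpa', ← hpb', hd]; ring
    have h₁ : 2 * p 1 * d = ‖b‖ ^ 2 * a 0 - ‖a‖ ^ 2 * b 0 := by
      rw [← hpa', ← hpb', hd]; ring
    calc (‖a‖ * ‖b‖ * ‖a - b‖) ^ 2
        = (‖a‖ ^ 2 * b 1 - ‖b‖ ^ 2 * a 1) ^ 2 + (‖b‖ ^ 2 * a 0 - ‖a‖ ^ 2 * b 0) ^ 2 := by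
          rw [mul_pow, mul_pow, normSq a, normSq b, normSq (a - b)]
          simp only [PiLp.sub_apply]
          ring
      _ = (2 * R * |d|) ^ 2 := by
          rw [← h₀, ← h₁, mul_pow _ |d|, mul_pow _ R, sq_abs, ← hpR, normSq p]
          ring
  have hd0 : 0 < |d| := by
    refine (abs_nonneg d).lt_of_ne fun h => ?_
    rw [← h, mul_zero] at circumradius
    exact (by positivity : ‖a‖ * ‖b‖ * ‖a - b‖ ≠ 0) circumradius
  have cramer : ‖w‖ * |d| ≤ 2 * M * (‖a‖ * ‖b‖) := by
    have norm_rot : ∀ x : E2, ‖(!₂[-x 1, x 0] : E2)‖ = ‖x‖ := fun x => by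
      refine (pow_left_inj₀ (norm_nonneg _) (norm_nonneg _) two_ne_zero).1 ?_
      rw [normSq, normSq]
      simp [add_comm]
    have hw : d • w = ⟪w, b⟫ • (!₂[-a 1, a 0] : E2) - ⟪w, a⟫ • (!₂[-b 1, b 0] : E2) := by
      ext i
      fin_cases i <;> simp [hd, PiLp.inner_apply, Fin.sum_univ_two] <;> ring
    calc ‖w‖ * |d| = ‖d • w‖ := by rw [norm_smul, Real.norm_eq_abs, mul_comm]
      _ ≤ |⟪w, b⟫| * ‖a‖ + |⟪w, a⟫| * ‖b‖ := by
        rw [hw]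
        refine (norm_sub_le _ _).trans_eq ?_
        rw [norm_smul, norm_smul, norm_rot, norm_rot, Real.norm_eq_abs, Real.norm_eq_abs]
      _ ≤ M * ‖b‖ * ‖a‖ + M * ‖a‖ * ‖b‖ := by gcongr
      _ = _ := by ring
  rw [hab]
  refine le_of_mul_le_mul_right ?_ hd0
  calc ‖w‖ * ‖a - b‖ * |d| = ‖w‖ * |d| * ‖a - b‖ := by ring
    _ ≤ 2 * M * (‖a‖ * ‖b‖) * ‖a - b‖ := by gcongr
    _ = 2 * M * (‖a‖ * ‖b‖ * ‖a - b‖) := by ring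
    _ = _ := by rw [circumradius]; ring

/-- The diameter of a square times the `L^q` average of the Hessian over it. -/
def hessScale (q : ℝ) (F : E2 → ℝ) (c : E2) (r : ℝ) : ℝ :=
  Metric.diam (square c r) * ((volume (square c r)).toReal⁻¹ *
    ∫ z in square c r, hessNorm F z ^ q) ^ (1 / q)

lemma hessScale_nonneg (q : ℝ) (F : E2 → ℝ) (c : E2) (r : ℝ) : 0 ≤ hessScale q F c r :=
  mul_nonneg Metric.diam_nonneg (Real.rpow_nonneg (mul_nonneg (by positivity)
    (integral_nonneg fun _ => Real.rpow_nonneg (Real.sqrt_nonneg _) _)) _)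

/-- Morrey's inequality for the gradient of a `C²` function on a square. -/
lemma norm_gradient_sub_gradient_le {q : ℝ} (hq : 2 < q) {F : E2 → ℝ} (hF : ContDiff ℝ 2 F)
    {c : E2} {r : ℝ} (hr : 0 < r) {x y : E2} (hx : x ∈ square c r) (hy : y ∈ square c r) :
    ‖gradient F x - gradient F y‖ ≤ 2 * (q / (q - 2)) * hessScale q F c r := by
  have hG : ContDiff ℝ 1 (fderiv ℝ F) := hF.fderiv_right (by norm_num)
  have morrey : ∀ z ∈ square c r, ‖fderiv ℝ F z - ⨍ y in square c r, fderiv ℝ F y‖ ≤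
      q / (q - 2) * hessScale q F c r := fun z hz => by
    have := norm_sub_setAverage_le (μ := volume) (isCompact_square c r) (convex_square c r)
      (volume_square_ne_zero c hr) (by linarith : 1 ≤ q) (by simpa using hq) hG
      (continuous_hessNorm hF) (norm_fderiv_fderiv_le_hessNorm F) hz
    rw [setAverage_eq _ fun z => hessNorm F z ^ q, finrank_euclideanSpace_fin,
      smul_eq_mul] at this
    refine this.trans_eq ?_
    rw [hessScale, Measure.real, Nat.cast_ofNat]
    ring
  have hiso : ‖gradient F x - gradient F y‖ = ‖fderiv ℝ F x - fderiv ℝ F y‖ := by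
    rw [gradient, gradient, ← map_sub, LinearIsometryEquiv.norm_map]
  rw [hiso]
  have hx' := morrey x hx
  have hy' := morrey y hy
  have := norm_sub_le_norm_sub_add_norm_sub (fderiv ℝ F x)
    (⨍ y in square c r, fderiv ℝ F y) (fderiv ℝ F y)
  rw [norm_sub_rev (fderiv ℝ F y)] at hy'
  linarith

/-- An affine function that interpolates `F` at two points of a square has, along the segment
between them, nearly the slope of `F` at any point of the square. -/
lemma abs_inner_sub_gradient_le {q : ℝ} (hq : 2 < q) {F : E2 → ℝ} (hF : ContDiff ℝ 2 F)
    {c : E2} {r : ℝ} (hr : 0 < r) {x y z : E2} (hx : x ∈ square c r) (hy : y ∈ square c r)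
    (hz : z ∈ square c r) {c₀ : ℝ} {v : E2} (hvx : c₀ + ⟪v, x⟫ = F x) (hvy : c₀ + ⟪v, y⟫ = F y) :
    |⟪v - gradient F z, y - x⟫| ≤ 2 * (q / (q - 2)) * hessScale q F c r * ‖y - x‖ := by
  have hdiff : Differentiable ℝ F := hF.differentiable two_ne_zero
  obtain ⟨ξ, hξ, hmvt⟩ := domain_mvt (s := square c r)
    (fun p _ => (hdiff p).hasFDerivAt.hasFDerivWithinAt) (convex_square c r) hx hy
  have hξ' : ξ ∈ square c r := (convex_square c r).segment_subset hx hy hξ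
  have hslope : ⟪v - gradient F z, y - x⟫ = ⟪gradient F ξ - gradient F z, y - x⟫ := by
    rw [inner_sub_left, inner_sub_left, gradient, gradient, InnerProductSpace.toDual_symm_apply,
      InnerProductSpace.toDual_symm_apply, ← hmvt, inner_sub_right, ← hvx, ← hvy]
    ring
  rw [hslope]
  refine (abs_real_inner_le_norm _ _).trans ?_
  gcongr
  exact norm_gradient_sub_gradient_le hq hF hr hξ' hz

/-- The gradient of the affine interpolant on a triangle approximates the gradient of `F` at a
point of a surrounding square. -/
lemma norm_interpolant_sub_gradient_le {q : ℝ} (hq : 2 < q) {F : E2 → ℝ} (hF : ContDiff ℝ 2 F)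
    {c : E2} {r : ℝ} (hr : 0 < r) {z₁ z₂ z₃ z : E2}
    (hnc : ¬ Collinear ℝ ({z₁, z₂, z₃} : Set E2))
    (hsub : ({z₁, z₂, z₃} : Set E2) ⊆ square c r) (hz : z ∈ square c r) {o : E2} {R : ℝ}
    (hR₁ : dist o z₁ = R) (hR₂ : dist o z₂ = R) (hR₃ : dist o z₃ = R) {c₀ : ℝ} {v : E2}
    (hv₁ : c₀ + ⟪v, z₁⟫ = F z₁) (hv₂ : c₀ + ⟪v, z₂⟫ = F z₂) (hv₃ : c₀ + ⟪v, z₃⟫ = F z₃) :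
    ‖v - gradient F z‖ ≤
      8 * (q / (q - 2)) * (R / Metric.diam ({z₁, z₂, z₃} : Set E2) * hessScale q F c r) := by
  have h₁₂ : z₁ ≠ z₂ := ne₁₂_of_not_collinear hnc
  have h₁₃ : z₁ ≠ z₃ := ne₁₃_of_not_collinear hnc
  have h₂₃ : z₂ ≠ z₃ := ne₂₃_of_not_collinear hnc
  have m₁ : z₁ ∈ square c r := hsub (by simp)
  have m₂ : z₂ ∈ square c r := hsub (by simp)
  have m₃ : z₃ ∈ square c r := hsub (by simp)
  have e₁₂ := abs_inner_sub_gradient_le hq hF hr m₁ m₂ hz hv₁ hv₂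
  have e₁₃ := abs_inner_sub_gradient_le hq hF hr m₁ m₃ hz hv₁ hv₃
  have e₂₁ := abs_inner_sub_gradient_le hq hF hr m₂ m₁ hz hv₂ hv₁
  have e₂₃ := abs_inner_sub_gradient_le hq hF hr m₂ m₃ hz hv₂ hv₃
  have e₃₁ := abs_inner_sub_gradient_le hq hF hr m₃ m₁ hz hv₃ hv₁
  have e₃₂ := abs_inner_sub_gradient_le hq hF hr m₃ m₂ hz hv₃ hv₂
  have b₁ := norm_mul_dist_le_of_edge_slopes h₁₂ h₁₃ h₂₃ hR₁ hR₂ hR₃ e₁₂ e₁₃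
  have b₂ := norm_mul_dist_le_of_edge_slopes h₁₂.symm h₂₃ h₁₃ hR₂ hR₁ hR₃ e₂₁ e₂₃
  have b₃ := norm_mul_dist_le_of_edge_slopes h₁₃.symm h₂₃.symm h₁₂ hR₃ hR₁ hR₂ e₃₁ e₃₂
  have hdiam : 0 < Metric.diam ({z₁, z₂, z₃} : Set E2) := by
    rw [Metric.diam_triple]
    exact lt_max_of_lt_right (dist_pos.2 h₂₃)
  have key : ‖v - gradient F z‖ * Metric.diam ({z₁, z₂, z₃} : Set E2) ≤
      4 * (2 * (q / (q - 2)) * hessScale q F c r) * R := by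
    rw [Metric.diam_triple, mul_max_of_nonneg _ _ (norm_nonneg _),
      mul_max_of_nonneg _ _ (norm_nonneg _)]
    exact max_le (max_le b₃ b₂) b₁
  refine ((le_div_iff₀ hdiam).2 key).trans_eq ?_
  ring

/-- Proposition 3.5 ("2TR"): for `2 < q < ∞` there is `C = C(q)` such that for any two
triangles `Δ = {z₁,z₂,z₃}`, `Δ' = {z₁',z₂',z₃'}` (with circumcenters `o`, `o'` and
circumradii `R`, `R'`), squares `Q ⊇ Δ`, `Q' ⊇ Δ'`, `Q̃ ⊇ Q ∪ Q'`, and every `C²` function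
`F : ℝ² → ℝ`,
`‖∇P_Δ[F] − ∇P_{Δ'}[F]‖₂ ≤ C { (R/diam Δ)·diam Q·avg_Q + (R'/diam Δ')·diam Q'·avg_{Q'}
  + diam Q̃·avg_{Q̃} }` where `avg_S = ((1/|S|)∫_S |∇²F|^q)^{1/q}` and the interpolating
affine polynomials are `y ↦ c₀ + ⟪v, y⟫` and `y ↦ c₀' + ⟪v', y⟫`. -/
theorem stmt13 (q : ℝ) (hq : 2 < q) :
    ∃ C : ℝ, 0 < C ∧
      ∀ z₁ z₂ z₃ z₁' z₂' z₃' : E2,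
        ¬ Collinear ℝ ({z₁, z₂, z₃} : Set E2) →
        ¬ Collinear ℝ ({z₁', z₂', z₃'} : Set E2) →
      ∀ (c : E2) (r : ℝ), 0 < r →
      ∀ (c' : E2) (r' : ℝ), 0 < r' →
      ∀ (ct : E2) (rt : ℝ), 0 < rt →
        ({z₁, z₂, z₃} : Set E2) ⊆ square c r →
        ({z₁', z₂', z₃'} : Set E2) ⊆ square c' r' →
        square c r ∪ square c' r' ⊆ square ct rt →
      ∀ (o : E2) (R : ℝ), 0 < R → dist o z₁ = R → dist o z₂ = R → dist o z₃ = R →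
      ∀ (o' : E2) (R' : ℝ), 0 < R' → dist o' z₁' = R' → dist o' z₂' = R' → dist o' z₃' = R' →
      ∀ (F : E2 → ℝ), ContDiff ℝ 2 F →
      ∀ (c₀ : ℝ) (v : E2),
        c₀ + ⟪v, z₁⟫ = F z₁ → c₀ + ⟪v, z₂⟫ = F z₂ → c₀ + ⟪v, z₃⟫ = F z₃ →
      ∀ (c₀' : ℝ) (v' : E2),
        c₀' + ⟪v', z₁'⟫ = F z₁' → c₀' + ⟪v', z₂'⟫ = F z₂' → c₀' + ⟪v', z₃'⟫ = F z₃' →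
        ‖v - v'‖ ≤
          C * ((R / Metric.diam ({z₁, z₂, z₃} : Set E2)) * Metric.diam (square c r) *
                ((volume (square c r)).toReal⁻¹ *
                  ∫ z in square c r, hessNorm F z ^ q) ^ (1 / q) +
              (R' / Metric.diam ({z₁', z₂', z₃'} : Set E2)) * Metric.diam (square c' r') *
                ((volume (square c' r')).toReal⁻¹ *
                  ∫ z in square c' r', hessNorm F z ^ q) ^ (1 / q) +
              Metric.diam (square ct rt) *
                ((volume (square ct rt)).toReal⁻¹ *
                  ∫ z in square ct rt, hessNorm F z ^ q) ^ (1 / q)) := by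
  have hq2 : 0 < q / (q - 2) := div_pos (by linarith) (by linarith)
  refine ⟨8 * (q / (q - 2)), by positivity, ?_⟩
  intro z₁ z₂ z₃ z₁' z₂' z₃' hnc hnc' c r hr c' r' hr' ct rt hrt hsub hsub' hunion
    o R _ hR₁ hR₂ hR₃ o' R' _ hR₁' hR₂' hR₃' F hF c₀ v hv₁ hv₂ hv₃ c₀' v' hv₁' hv₂' hv₃'
  have m : z₁ ∈ square c r := hsub (by simp)
  have m' : z₁' ∈ square c' r' := hsub' (by simp)
  have b := norm_interpolant_sub_gradient_le hq hF hr hnc hsub m hR₁ hR₂ hR₃ hv₁ hv₂ hv₃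
  have b' := norm_interpolant_sub_gradient_le hq hF hr' hnc' hsub' m' hR₁' hR₂' hR₃' hv₁' hv₂' hv₃'
  have bt := norm_gradient_sub_gradient_le hq hF hrt (hunion (Or.inl m)) (hunion (Or.inr m'))
  have ht : 0 ≤ q / (q - 2) * hessScale q F ct rt :=
    mul_nonneg hq2.le (hessScale_nonneg q F ct rt)
  have tri₁ := norm_sub_le_norm_sub_add_norm_sub v (gradient F z₁) v'
  have tri₂ := norm_sub_le_norm_sub_add_norm_sub (gradient F z₁) (gradient F z₁') v'
  rw [norm_sub_rev v'] at b'
  rw [mul_assoc (R / _), mul_assoc (R' / _)]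
  change _ ≤ 8 * (q / (q - 2)) * (_ * hessScale q F c r + _ * hessScale q F c' r' +
    hessScale q F ct rt)
  linarith
end
end

section
/- Let 2 < q < ∞. There exists a constant C depending only on q with the following property. Let F : ℝ² → ℝ be a C² function and let Q be a square in ℝ² containing three collinear points z₁, z₂, z₃ with z₂ in the open line segment (z₁, z₃). Then |(F(z₁) − F(z₂))/‖z₁ − z₂‖₂ − (F(z₂) − F(z₃))/‖z₂ − z₃‖₂| ≤ C · diam Q · ( (1/|Q|) ∫_Q |∇²F(z)|^q dz )^{1/q}. -/
open MeasureTheory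
open scoped RealInnerProductSpace

noncomputable section

section Morrey

open Module Set

lemma setIntegral_le_measureReal_mul_rpow {X : Type*} [TopologicalSpace X] [T2Space X]
    [MeasurableSpace X] [BorelSpace X] {μ : Measure X} {S : Set X}
    [IsFiniteMeasureOnCompacts μ] (hS : IsCompact S) (hμ : μ S ≠ 0) {q : ℝ} (hq : 1 ≤ q)
    {f : X → ℝ} (hf : Continuous f) (hf0 : ∀ z, 0 ≤ f z) :
    ∫ z in S, f z ∂μ ≤ μ.real S * ((μ.real S)⁻¹ * ∫ z in S, f z ^ q ∂μ) ^ (1 / q) := by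
  have hfq : Continuous fun z => f z ^ q := hf.rpow_const fun _ => .inr (by linarith)
  have hV : 0 < μ.real S := ENNReal.toReal_pos hμ hS.measure_lt_top.ne
  have hJ := (convexOn_rpow hq).map_set_average_le (μ := μ) (t := S) (f := f)
    (Real.continuous_rpow_const (by linarith)).continuousOn isClosed_Ici hμ hS.measure_lt_top.ne
    (.of_forall hf0) (hf.continuousOn.integrableOn_compact hS)
    (hfq.continuousOn.integrableOn_compact hS)
  simp only [setAverage_eq, smul_eq_mul] at hJ
  have h0 : 0 ≤ (μ.real S)⁻¹ * ∫ z in S, f z ∂μ :=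
    mul_nonneg (by positivity) (integral_nonneg hf0)
  rw [← inv_mul_le_iff₀ hV]
  calc _ = (((μ.real S)⁻¹ * ∫ z in S, f z ∂μ) ^ q) ^ (1 / q) := by
        rw [← Real.rpow_mul h0, mul_one_div_cancel (by linarith), Real.rpow_one]
    _ ≤ _ := Real.rpow_le_rpow (Real.rpow_nonneg h0 _) hJ (by positivity)

variable {E : Type*} [NormedAddCommGroup E] [NormedSpace ℝ E] [FiniteDimensional ℝ E]
  [MeasurableSpace E] [BorelSpace E] {μ : Measure E} {S : Set E}

lemma setIntegral_comp_homothety_le [μ.IsAddHaarMeasure] (hS : IsCompact S) (hc : Convex ℝ S)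
    {x : E} (hx : x ∈ S) {t : ℝ} (ht0 : 0 < t) (ht1 : t ≤ 1) {f : E → ℝ} (hf : Continuous f)
    (hf0 : ∀ z, 0 ≤ f z) :
    ∫ z in S, f (x + t • (z - x)) ∂μ ≤ (t ^ finrank ℝ E)⁻¹ * ∫ z in S, f z ∂μ := by
  have hint : Integrable (S.indicator f) μ :=
    (hf.continuousOn.integrableOn_compact hS).integrable_indicator hS.measurableSet
  have hscale : ∫ z, S.indicator f (x + t • (z - x)) ∂μ
      = (t ^ finrank ℝ E)⁻¹ * ∫ z in S, f z ∂μ := by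
    rw [integral_sub_right_eq_self (fun z => S.indicator f (x + t • z)) x,
      Measure.integral_comp_smul μ (fun z => S.indicator f (x + z)) t,
      integral_add_left_eq_self (S.indicator f) x, integral_indicator hS.measurableSet,
      abs_of_nonneg (by positivity), smul_eq_mul]
  rw [← hscale, ← integral_indicator hS.measurableSet]
  refine integral_mono_of_nonneg (.of_forall fun z => indicator_nonneg (fun _ _ => hf0 _) z)
    ?_ (.of_forall fun z => ?_)
  · have h1 : Integrable (fun z => S.indicator f (x + z)) μ := hint.comp_add_left x
    have h2 : Integrable (fun z => S.indicator f (x + t • z)) μ := h1.comp_smul ht0.ne'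
    exact h2.comp_sub_right x
  · by_cases hz : z ∈ S
    · have : x + t • (z - x) ∈ S := hc.add_smul_sub_mem hx hz ⟨ht0.le, ht1⟩
      simp [hz, this]
    · simpa [hz] using indicator_nonneg (fun _ _ => hf0 _) _

/-- The Morrey inequality on a compact convex set, comparing a value with the mean value. -/
theorem abs_setAverage_sub_le_morrey [μ.IsAddHaarMeasure] (hS : IsCompact S) (hc : Convex ℝ S)
    (hμ : μ S ≠ 0) {q : ℝ} (hq1 : 1 ≤ q) (hq : finrank ℝ E < q) {G : E → ℝ} (hG : ContDiff ℝ 1 G)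
    {x : E} (hx : x ∈ S) :
    |⨍ z in S, G z ∂μ - G x| ≤ q / (q - finrank ℝ E) * Metric.diam S *
      ((μ.real S)⁻¹ * ∫ z in S, ‖fderiv ℝ G z‖ ^ q ∂μ) ^ (1 / q) := by
  set d : ℝ := (finrank ℝ E : ℝ) with hd
  set V := μ.real S with hVdef
  set M := (V⁻¹ * ∫ z in S, ‖fderiv ℝ G z‖ ^ q ∂μ) ^ (1 / q) with hM
  have hq0 : 0 < q := by linarith
  have hV : 0 < V := ENNReal.toReal_pos hμ hS.measure_lt_top.ne
  have hG' : Continuous (fderiv ℝ G) := hG.continuous_fderiv one_ne_zero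
  have hI0 : 0 ≤ V⁻¹ * ∫ z in S, ‖fderiv ℝ G z‖ ^ q ∂μ :=
    mul_nonneg (by positivity) (integral_nonneg fun _ => by positivity)
  have hfin : IsFiniteMeasure (μ.restrict S) := ⟨by simpa using hS.measure_lt_top⟩
  let K : ℝ → E → ℝ := fun t z => fderiv ℝ G (x + t • (z - x)) (z - x)
  have hK : Continuous (Function.uncurry K) := by
    have : Continuous fun p : ℝ × E => x + p.1 • (p.2 - x) := by fun_prop
    exact (hG'.comp this).clm_apply (by fun_prop)
  have hftc (z : E) : ∫ t in (0 : ℝ)..1, K t z = G z - G x := by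
    have hder (t : ℝ) : HasDerivAt (fun t : ℝ => G (x + t • (z - x))) (K t z) t := by
      have h1 : HasDerivAt (fun t : ℝ => x + t • (z - x)) (z - x) t := by
        simpa using ((hasDerivAt_id t).smul_const (z - x)).const_add x
      exact (hG.differentiable one_ne_zero _).hasFDerivAt.comp_hasDerivAt t h1
    have hcont : Continuous fun t => K t z := hK.comp (by fun_prop : Continuous fun t => (t, z))
    rw [intervalIntegral.integral_eq_sub_of_hasDerivAt (fun t _ => hder t)
      (hcont.intervalIntegrable 0 1)]
    simp
  have hswap : ∫ t in (0 : ℝ)..1, ∫ z in S, K t z ∂μ = ∫ z in S, (G z - G x) ∂μ := by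
    rw [intervalIntegral_integral_swap]
    · simp only [hftc]
    · rw [Measure.prod_restrict, uIoc_of_le zero_le_one]
      exact (hK.continuousOn.integrableOn_compact (isCompact_Icc.prod hS)).mono_set
        (prod_mono Ioc_subset_Icc_self subset_rfl)
  have hbound (t : ℝ) (ht : t ∈ Ioc (0 : ℝ) 1) :
      ‖∫ z in S, K t z ∂μ‖ ≤ Metric.diam S * (V * M) * t ^ (-(d / q)) := by
    have hline : Continuous fun z : E => x + t • (z - x) := by fun_prop
    have hcont : Continuous fun z => ‖fderiv ℝ G (x + t • (z - x))‖ := (hG'.comp hline).norm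
    calc ‖∫ z in S, K t z ∂μ‖
        ≤ ∫ z in S, ‖fderiv ℝ G (x + t • (z - x))‖ * Metric.diam S ∂μ := by
          refine norm_integral_le_of_norm_le
            ((hcont.mul continuous_const).continuousOn.integrableOn_compact hS) ?_
          filter_upwards [ae_restrict_mem hS.measurableSet] with z hz
          refine (ContinuousLinearMap.le_opNorm _ _).trans ?_
          gcongr
          rw [← dist_eq_norm]
          exact Metric.dist_le_diam_of_mem hS.isBounded hz hx
      _ = Metric.diam S * ∫ z in S, ‖fderiv ℝ G (x + t • (z - x))‖ ∂μ := by
          rw [integral_mul_const, mul_comm]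
      _ ≤ Metric.diam S *
          (V * (V⁻¹ * ∫ z in S, ‖fderiv ℝ G (x + t • (z - x))‖ ^ q ∂μ) ^ (1 / q)) := by
          gcongr
          exact setIntegral_le_measureReal_mul_rpow hS hμ hq1 hcont fun _ => norm_nonneg _
      _ ≤ Metric.diam S * (V * (V⁻¹ * ((t ^ finrank ℝ E)⁻¹ *
          ∫ z in S, ‖fderiv ℝ G z‖ ^ q ∂μ)) ^ (1 / q)) := by
          have := setIntegral_comp_homothety_le (μ := μ) hS hc hx ht.1 ht.2
            (hG'.norm.rpow_const fun _ => .inr hq0.le) fun _ => by positivity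
          have h0 : 0 ≤ ∫ z in S, ‖fderiv ℝ G (x + t • (z - x))‖ ^ q ∂μ :=
            integral_nonneg fun _ => by positivity
          have := Metric.diam_nonneg (s := S)
          gcongr
      _ = Metric.diam S * (V * M) * t ^ (-(d / q)) := by
          have : ((t ^ finrank ℝ E)⁻¹) ^ (1 / q) = t ^ (-(d / q)) := by
            rw [← Real.rpow_natCast, ← Real.rpow_neg ht.1.le, ← Real.rpow_mul ht.1.le, hd]
            congr 1
            ring
          rw [mul_left_comm V⁻¹, Real.mul_rpow (inv_nonneg.2 (pow_nonneg ht.1.le _)) hI0, this]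
          ring
  have hdq : d / q < 1 := (div_lt_one hq0).2 hq
  have hmain : |∫ z in S, (G z - G x) ∂μ| ≤ Metric.diam S * (V * M) * (q / (q - d)) := by
    have := intervalIntegral.norm_integral_le_of_norm_le zero_le_one
      (.of_forall hbound : ∀ᵐ t, t ∈ Ioc (0 : ℝ) 1 → _)
      ((intervalIntegral.intervalIntegrable_rpow' (by linarith)).const_mul _)
    rw [hswap, intervalIntegral.integral_const_mul, integral_rpow (.inl (by linarith)),
      Real.one_rpow, Real.zero_rpow (by linarith), Real.norm_eq_abs] at this
    refine this.trans_eq ?_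
    have : q - d ≠ 0 := by linarith
    congr 1
    have h3 : -(d / q) + 1 = (q - d) / q := by field_simp; ring
    rw [h3, sub_zero, one_div_div]
  have hav : ⨍ z in S, G z ∂μ - G x = V⁻¹ * ∫ z in S, (G z - G x) ∂μ := by
    rw [integral_sub (hG.continuous.continuousOn.integrableOn_compact hS) (integrable_const _),
      setAverage_eq, setIntegral_const, smul_eq_mul, smul_eq_mul, ← hVdef]
    field_simp
  rw [hav, abs_mul, abs_of_pos (inv_pos.2 hV), inv_mul_le_iff₀ hV]
  exact hmain.trans_eq (by ring)

end Morrey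

lemma abs_fderiv_fderiv_apply_le_hessNorm (F : E2 → ℝ) (z v u : E2) :
    |fderiv ℝ (fderiv ℝ F) z v u| ≤ hessNorm F z * ‖v‖ * ‖u‖ := by
  set B := fderiv ℝ (fderiv ℝ F) z
  have hdec (w : E2) : w = w 0 • EuclideanSpace.single 0 (1 : ℝ)
      + w 1 • EuclideanSpace.single 1 (1 : ℝ) := by
    ext i
    fin_cases i <;> simp
  have hB : B v u = ∑ i, ∑ j, v i * u j *
      B (EuclideanSpace.single i 1) (EuclideanSpace.single j 1) := by
    conv_lhs => rw [hdec v, hdec u]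
    simp [Fin.sum_univ_two]
    ring
  simp only [hessNorm, iteratedFDeriv_two_apply, Matrix.cons_val_zero, Matrix.cons_val_one,
    EuclideanSpace.norm_eq, Real.norm_eq_abs, sq_abs]
  rw [← Real.sqrt_mul (by positivity), ← Real.sqrt_mul (by positivity), hB]
  refine Real.abs_le_sqrt ?_
  simp only [← Fintype.sum_prod_type']
  refine (Finset.sum_mul_sq_le_sq_mul_sq _ (fun p : Fin 2 × Fin 2 => v p.1 * u p.2) _).trans_eq ?_
  simp only [Fintype.sum_prod_type, Fin.sum_univ_two]
  ring

/-- Oscillation of a directional derivative on a square. -/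
lemma abs_fderiv_apply_sub_le {q : ℝ} (hq : 2 < q) {F : E2 → ℝ} (hF : ContDiff ℝ 2 F)
    {c : E2} {r : ℝ} (hr : 0 < r) {x y u : E2} (hx : x ∈ square c r) (hy : y ∈ square c r)
    (hu : ‖u‖ ≤ 1) :
    |fderiv ℝ F x u - fderiv ℝ F y u| ≤ 2 * (q / (q - 2)) * Metric.diam (square c r) *
      ((volume (square c r)).toReal⁻¹ * ∫ z in square c r, hessNorm F z ^ q) ^ (1 / q) := by
  have hS := isCompact_square c r
  have hF' : ContDiff ℝ 1 (fderiv ℝ F) := hF.fderiv_right (by norm_num)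
  have hG : ContDiff ℝ 1 fun z => fderiv ℝ F z u := hF'.clm_apply contDiff_const
  have hle (z : E2) : ‖fderiv ℝ (fun z => fderiv ℝ F z u) z‖ ≤ hessNorm F z := by
    refine ContinuousLinearMap.opNorm_le_bound _ (Real.sqrt_nonneg _) fun v => ?_
    rw [fderiv_clm_apply (hF'.differentiable one_ne_zero z) (differentiableAt_const u)]
    simp only [fderiv_fun_const, Pi.zero_apply, ContinuousLinearMap.comp_zero, zero_add,
      ContinuousLinearMap.flip_apply, Real.norm_eq_abs]
    exact (abs_fderiv_fderiv_apply_le_hessNorm F z v u).trans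
      (mul_le_of_le_one_right (mul_nonneg (Real.sqrt_nonneg _) (norm_nonneg _)) hu)
  have hint : ∫ z in square c r, ‖fderiv ℝ (fun z => fderiv ℝ F z u) z‖ ^ q
      ≤ ∫ z in square c r, hessNorm F z ^ q := by
    refine integral_mono_of_nonneg (.of_forall fun z => by positivity) ?_ (.of_forall fun z => ?_)
    · exact ((continuous_hessNorm hF).rpow_const
        fun _ => .inr (by linarith)).continuousOn.integrableOn_compact hS
    · exact Real.rpow_le_rpow (norm_nonneg _) (hle z) (by linarith)
  have key (w : E2) (hw : w ∈ square c r) := abs_setAverage_sub_le_morrey (μ := volume) hS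
    (convex_square c r) (volume_square_ne_zero c hr) (q := q) (by linarith)
    (by simpa using hq) hG hw
  simp only [finrank_euclideanSpace, Fintype.card_fin, Nat.cast_ofNat] at key
  have hmono : ((volume (square c r)).toReal⁻¹ *
        ∫ z in square c r, ‖fderiv ℝ (fun z => fderiv ℝ F z u) z‖ ^ q) ^ (1 / q)
      ≤ ((volume (square c r)).toReal⁻¹ * ∫ z in square c r, hessNorm F z ^ q) ^ (1 / q) := by
    have : 0 ≤ ∫ z in square c r, ‖fderiv ℝ (fun z => fderiv ℝ F z u) z‖ ^ q :=
      integral_nonneg fun _ => by positivity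
    gcongr
  have hcoef : 0 ≤ q / (q - 2) * Metric.diam (square c r) :=
    mul_nonneg (div_nonneg (by linarith) (by linarith)) Metric.diam_nonneg
  have hmul := mul_le_mul_of_nonneg_left hmono hcoef
  have h1 := (key x hx).trans hmul
  have h2 := (key y hy).trans hmul
  rw [abs_le] at h1 h2 ⊢
  constructor <;> linarith

/-- Lemma 3.3 ("3POINTS"): for `2 < q < ∞` there is `C = C(q)` such that for every `C²`
function `F : ℝ² → ℝ` and every square `Q = Q(c,r)` containing three collinear points
`z₁, z₂, z₃` with `z₂` in the open segment `(z₁, z₃)`,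
`|(F z₁ − F z₂)/‖z₁ − z₂‖₂ − (F z₂ − F z₃)/‖z₂ − z₃‖₂| ≤
  C · diam Q · ((1/|Q|) ∫_Q |∇²F|^q)^{1/q}`. -/
theorem stmt14 (q : ℝ) (hq : 2 < q) :
    ∃ C : ℝ, 0 < C ∧
      ∀ (F : E2 → ℝ), ContDiff ℝ 2 F →
      ∀ (c : E2) (r : ℝ), 0 < r →
      ∀ z₁ z₂ z₃ : E2, z₁ ≠ z₃ → z₂ ∈ openSegment ℝ z₁ z₃ →
        z₁ ∈ square c r → z₂ ∈ square c r → z₃ ∈ square c r →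
        |(F z₁ - F z₂) / dist z₁ z₂ - (F z₂ - F z₃) / dist z₂ z₃| ≤
          C * Metric.diam (square c r) *
            ((volume (square c r)).toReal⁻¹ * ∫ z in square c r, hessNorm F z ^ q) ^ (1 / q) := by
  refine ⟨2 * (q / (q - 2)), mul_pos two_pos (div_pos (by linarith) (by linarith)), ?_⟩
  intro F hF c r hr z₁ z₂ z₃ hne hz₂ hm₁ hm₂ hm₃
  obtain ⟨a, b, ha, hb, hab, rfl⟩ := hz₂
  set z₂ := a • z₁ + b • z₃
  set w := z₁ - z₃
  have hw : 0 < ‖w‖ := norm_pos_iff.2 (sub_ne_zero.2 hne)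
  have h12 : z₁ - z₂ = b • w := by
    have : a = 1 - b := by linarith
    simp only [z₂, w, this]
    module
  have h23 : z₂ - z₃ = a • w := by
    have : b = 1 - a := by linarith
    simp only [z₂, w, this]
    module
  have hquot (x y : E2) (s : ℝ) (hs : 0 < s) (hxy : x - y = s • w) (hx : x ∈ square c r)
      (hy : y ∈ square c r) :
      ∃ p ∈ square c r, (F x - F y) / dist x y = fderiv ℝ F p (‖w‖⁻¹ • w) := by
    obtain ⟨p, hp, hFp⟩ := domain_mvt
      (fun p _ => ((hF.differentiable two_ne_zero p).hasFDerivAt.hasFDerivWithinAt))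
      (convex_square c r) hy hx
    refine ⟨p, (convex_square c r).segment_subset hy hx hp, ?_⟩
    rw [hFp, dist_eq_norm, hxy, norm_smul, Real.norm_of_nonneg hs.le, map_smul, map_smul,
      smul_eq_mul, smul_eq_mul]
    field_simp
  obtain ⟨p, hp, hp'⟩ := hquot z₁ z₂ b hb h12 hm₁ hm₂
  obtain ⟨p', hm, hp''⟩ := hquot z₂ z₃ a ha h23 hm₂ hm₃
  rw [hp', hp'']
  refine abs_fderiv_apply_sub_le hq hF hr hp hm ?_
  rw [norm_smul, norm_inv, norm_norm, inv_mul_cancel₀ hw.ne']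
end
end

section
/- Let ℓ₁ and ℓ₂ be two non-parallel straight lines (one-dimensional affine subspaces) in Euclidean ℝ² intersecting at a point a, and let α ∈ (0, π/2) be the angle between them. Then for every x, y ∈ ℝ², ‖Pr(x; ℓ₁) − Pr(y; ℓ₂)‖₂ ≤ ‖x − y‖₂ + 2√2 · sin α · ‖x − a‖₂. -/
open scoped RealInnerProductSpace

section LineProjection

variable {E : Type*} [NormedAddCommGroup E] [InnerProductSpace ℝ E]

theorem norm_inner_smul_le {u : E} (hu : ‖u‖ = 1) (z : E) : ‖⟪z, u⟫ • u‖ ≤ ‖z‖ := by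
  simpa [norm_smul, hu] using abs_real_inner_le_norm z u

/-- The difference of the orthogonal projections onto two lines through the origin has operator
norm at most the sine of the angle between them. -/
theorem norm_inner_smul_sub_inner_smul_sq_le {u v : E} (hu : ‖u‖ = 1) (hv : ‖v‖ = 1) (z : E) :
    ‖⟪z, u⟫ • u - ⟪z, v⟫ • v‖ ^ 2 ≤ (1 - ⟪u, v⟫ ^ 2) * ‖z‖ ^ 2 := by
  have huu : ⟪u, u⟫ = 1 := by simp [hu]
  have hvv : ⟪v, v⟫ = 1 := by simp [hv]
  have hzu : ⟪u, z⟫ = ⟪z, u⟫ := real_inner_comm z u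
  have huv : ⟪v, u⟫ = ⟪u, v⟫ := real_inner_comm u v
  have hcs := real_inner_mul_inner_self_le (z - ⟪z, u⟫ • u) (v - ⟪u, v⟫ • u)
  rw [← real_inner_self_eq_norm_sq, ← real_inner_self_eq_norm_sq]
  simp only [inner_sub_left, inner_sub_right, real_inner_smul_left, real_inner_smul_right,
    huu, hvv, hzu, huv] at hcs ⊢
  linarith

end LineProjection

/-- Lemma 8.8 ("G-PR"): let `ℓ₁ = a + ℝu₁` and `ℓ₂ = a + ℝu₂` be two straight lines in
Euclidean `ℝ²` through a common point `a`, with unit direction vectors `u₁`, `u₂`, and let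
`α ∈ (0, π/2)` be the angle between them, so `cos α = |⟪u₁, u₂⟫|`.  Then for all `x, y ∈ ℝ²`,
`‖Pr(x; ℓ₁) − Pr(y; ℓ₂)‖₂ ≤ ‖x − y‖₂ + 2√2 · sin α · ‖x − a‖₂`, where the orthogonal
projection onto the line `a + ℝu` (with `‖u‖ = 1`) is `Pr(x) = a + ⟪x − a, u⟫ u`. -/
theorem stmt15 (a u₁ u₂ : EuclideanSpace ℝ (Fin 2))
    (hu₁ : ‖u₁‖ = 1) (hu₂ : ‖u₂‖ = 1)
    (α : ℝ) (hα₀ : 0 < α) (hα₁ : α < Real.pi / 2)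
    (hcos : Real.cos α = |⟪u₁, u₂⟫|)
    (x y : EuclideanSpace ℝ (Fin 2)) :
    ‖(a + ⟪x - a, u₁⟫ • u₁) - (a + ⟪y - a, u₂⟫ • u₂)‖ ≤
      ‖x - y‖ + 2 * Real.sqrt 2 * Real.sin α * ‖x - a‖ := by
  have hsin : 0 ≤ Real.sin α :=
    Real.sin_nonneg_of_nonneg_of_le_pi hα₀.le (by linarith [Real.pi_pos])
  have hsq : 1 - ⟪u₁, u₂⟫ ^ 2 = Real.sin α ^ 2 := by
    rw [Real.sin_sq, hcos, sq_abs]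
  have hdiff : ‖⟪x - a, u₁⟫ • u₁ - ⟪x - a, u₂⟫ • u₂‖ ≤ Real.sin α * ‖x - a‖ := by
    refine le_of_sq_le_sq ?_ (by positivity)
    rw [mul_pow, ← hsq]
    exact norm_inner_smul_sub_inner_smul_sq_le hu₁ hu₂ (x - a)
  have hconst : (1 : ℝ) ≤ 2 * Real.sqrt 2 := by
    have : (1 : ℝ) ≤ Real.sqrt 2 := Real.one_le_sqrt.mpr one_le_two
    linarith
  have hsplit : (a + ⟪x - a, u₁⟫ • u₁) - (a + ⟪y - a, u₂⟫ • u₂) =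
      ⟪x - y, u₂⟫ • u₂ + (⟪x - a, u₁⟫ • u₁ - ⟪x - a, u₂⟫ • u₂) := by
    rw [← sub_sub_sub_cancel_right x y a, inner_sub_left (x - a) (y - a), sub_smul]
    abel
  rw [hsplit]
  refine (norm_add_le _ _).trans (add_le_add (norm_inner_smul_le hu₂ _) (hdiff.trans ?_))
  rw [mul_assoc]
  exact le_mul_of_one_le_left (by positivity) hconst
end
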